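/- Let E be a real vector space, let τ ≥ 1, and for each s ∈ {1,…,τ} let n_s be a natural number and c_s, g_s ∈ E. Define f_s : E → E by f_s(z) = (1/(n_s+1)) • (z + c_s) − g_s, and let F = f_τ ∘ ⋯ ∘ f_1. Then F is a bijection of E. Consequently, for every target estimate t ∈ E there exists a broadcast value y ∈ E such that F(y) = t: a Byzantine node at distance τ along a path of benign nodes using the average aggregation rule can drive the estimate of the node at the end of the path to any prescribed vector after τ iterations. -/

import Mathlib

/-- Composition of the hop maps along the path: `pathComp f 0 = id` and
`pathComp f (k+1) = f (k+1) ∘ pathComp f k`, so that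
`pathComp f τ = f τ ∘ f (τ-1) ∘ ⋯ ∘ f 1`. -/
def pathComp {E : Type*} (f : ℕ → E → E) : ℕ → E → E
  | 0 => id
  | k + 1 => f (k + 1) ∘ pathComp f k

/-- The composition of the hop maps along a path of `τ` benign nodes using the
average aggregation rule is a bijection of `E`; hence for every target
estimate `t` there exists a broadcast value `y` driving the estimate at the
end of the path to `t` after `τ` iterations. -/
theorem byzantine_path_bijective
    {E : Type*} [AddCommGroup E] [Module ℝ E]
    (τ : ℕ) (hτ : 1 ≤ τ)
    (n : ℕ → ℕ) (c g : ℕ → E)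
    (f : ℕ → E → E)
    (hf : ∀ s, f s = fun z => (1 / ((n s : ℝ) + 1)) • (z + c s) - g s) :
    Function.Bijective (pathComp f τ) ∧
      ∀ t : E, ∃ y : E, pathComp f τ y = t := by
  have hb : ∀ s, Function.Bijective (f s) := by
    intro s
    have hn : ((n s : ℝ) + 1) ≠ 0 := by positivity
    rw [hf s]
    refine Function.bijective_iff_has_inverse.mpr
      ⟨fun w => ((n s : ℝ) + 1) • (w + g s) - c s, fun z => ?_, fun w => ?_⟩
    · simp [smul_smul, hn]
    · simp [smul_smul, hn]
  have hk : ∀ k, Function.Bijective (pathComp f k) := by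
    intro k
    induction k with
    | zero => exact Function.bijective_id
    | succ k ih => exact (hb (k + 1)).comp ih
  exact ⟨hk τ, (hk τ).surjective⟩
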